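/- Kneading preserves the alternant of a finite sequence of positive integers. -/

import Mathlib

/-- The continuant of a finite sequence of integers. -/
def cont : List ℤ → ℤ
  | [] => 1
  | [q] => q
  | q :: r :: t => q * cont (r :: t) + cont t

/-- The continuant of the sequence with first and last entries removed,
with the convention that it is `0` for sequences of length `≤ 1`. -/
def contMid : List ℤ → ℤ
  | [] => 0
  | [_] => 0
  | _ :: t => cont t.dropLast

/-- The alternant of a finite sequence of integers. -/
def alternant (l : List ℤ) : ℤ := cont l - contMid l

/-- Pinch the left end of a sequence. -/
def pinchL : List ℤ → List ℤ
  | [] => []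
  | [x] => if x = 1 then [x] else [1, x - 1]
  | x :: y :: t => if x = 1 then (y + 1) :: t else 1 :: (x - 1) :: y :: t

/-- Pinch the right end of a sequence. -/
def pinchR (l : List ℤ) : List ℤ := (pinchL l.reverse).reverse

/-- Knead a sequence: remove the leftmost entry, pinch both ends of the
remainder, and append the removed entry on the right. -/
def knead : List ℤ → List ℤ
  | [] => []
  | x :: t => pinchR (pinchL t) ++ [x]

def mOne (q : ℤ) : Matrix (Fin 2) (Fin 2) ℤ := !![q, 1; 1, 0]

def mList (l : List ℤ) : Matrix (Fin 2) (Fin 2) ℤ := (l.map mOne).prod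

def mP : Matrix (Fin 2) (Fin 2) ℤ := !![1, 0; 1, -1]

theorem mList_nil : mList [] = 1 := rfl

theorem mList_cons (x : ℤ) (l : List ℤ) : mList (x :: l) = mOne x * mList l := by
  simp [mList]

theorem mList_append (l k : List ℤ) : mList (l ++ k) = mList l * mList k := by
  simp [mList]

theorem mList_reverse (l : List ℤ) : mList l.reverse = (mList l).transpose := by
  induction l with
  | nil => simp [mList_nil]
  | cons x t ih =>
    have h : (mOne x).transpose = mOne x := by
      ext i j; fin_cases i <;> fin_cases j <;> rfl
    rw [List.reverse_cons, mList_append, ih, mList_cons, mList_cons, mList_nil, mul_one,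
      Matrix.transpose_mul, h]

theorem cont_eq (l : List ℤ) : cont l = mList l 0 0 := by
  induction l using cont.induct with
  | case1 => simp [cont, mList_nil]
  | case2 q => simp [cont, mList, mOne]
  | case3 q r t ih1 ih2 =>
    rw [cont, ih1, ih2]
    simp [mList_cons, mOne, Matrix.mul_apply, Fin.sum_univ_two, Matrix.vecMul, dotProduct]

theorem contMid_eq (x : ℤ) (t : List ℤ) : contMid (x :: t) = mList (x :: t) 1 1 := by
  rcases List.eq_nil_or_concat t with rfl | ⟨s, y, rfl⟩
  · simp [contMid, mList, mOne]
  · have h : contMid (x :: (s ++ [y])) = cont s := by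
      rw [contMid]
      · simp
      · simp
    simp only [List.concat_eq_append] at *
    rw [h, cont_eq]
    simp [mList_cons, mList_append, mList_nil, mOne, Matrix.mul_apply, Fin.sum_univ_two]

theorem alternant_eq (l : List ℤ) (h : l ≠ []) :
    alternant l = mList l 0 0 - mList l 1 1 := by
  cases l with
  | nil => exact absurd rfl h
  | cons x t => rw [alternant, cont_eq, contMid_eq]

theorem mP_one (x : ℤ) : mOne 1 * mOne (x - 1) = mP * mOne x := by
  ext i j
  fin_cases i <;> fin_cases j <;>
    simp [mOne, mP, Matrix.mul_apply, Fin.sum_univ_two, sub_eq_add_neg]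

theorem mP_two (y : ℤ) : mOne (y + 1) = mP * (mOne 1 * mOne y) := by
  ext i j
  fin_cases i <;> fin_cases j <;>
    simp [mOne, mP, Matrix.mul_apply, Fin.sum_univ_two]

theorem mList_pinchL (l : List ℤ) (h0 : l ≠ []) (h1 : l ≠ [1]) :
    mList (pinchL l) = mP * mList l := by
  rcases l with _ | ⟨x, _ | ⟨y, t⟩⟩
  · exact absurd rfl h0
  · have hx : x ≠ 1 := fun h => h1 (by rw [h])
    simp only [pinchL, if_neg hx, mList_cons, mList_nil, mul_one, mP_one]
  · by_cases hx : x = 1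
    · subst hx
      simp only [pinchL, if_true, mList_cons, mP_two, mul_assoc]
    · simp only [pinchL, if_neg hx, mList_cons]
      rw [← mul_assoc, mP_one, mul_assoc]

theorem mList_pinchR (l : List ℤ) (h0 : l ≠ []) (h1 : l ≠ [1]) :
    mList (pinchR l) = mList l * mP.transpose := by
  rw [pinchR, mList_reverse, mList_pinchL, mList_reverse, Matrix.transpose_mul,
    Matrix.transpose_transpose]
  · simpa using h0
  · intro h; apply h1; simpa using congrArg List.reverse h

theorem pinchL_ne (l : List ℤ) (hpos : ∀ x ∈ l, 0 < x) (h0 : l ≠ []) (h1 : l ≠ [1]) :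
    pinchL l ≠ [] ∧ pinchL l ≠ [1] := by
  rcases l with _ | ⟨x, _ | ⟨y, t⟩⟩
  · exact absurd rfl h0
  · have hx : x ≠ 1 := fun h => h1 (by rw [h])
    simp [pinchL, hx]
  · have hy : 0 < y := hpos y (by simp)
    by_cases hx : x = 1
    · simp [pinchL, hx]; intro h; omega
    · simp [pinchL, hx]

theorem knead_alternant (l : List ℤ) (hpos : ∀ x ∈ l, 0 < x) :
    alternant (knead l) = alternant l := by
  rcases l with _ | ⟨x, t⟩
  · rfl
  by_cases h0 : t = []
  · subst h0; rfl
  by_cases h1 : t = [1]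
  · subst h1
    simp [knead, pinchL, pinchR, alternant, cont, contMid]
  obtain ⟨h2, h3⟩ := pinchL_ne t (fun y hy => hpos y (by simp [hy])) h0 h1
  rw [knead, alternant_eq _ (by simp), alternant_eq _ (by simp), mList_append,
    mList_pinchR _ h2 h3, mList_pinchL _ h0 h1, mList_cons, mList_cons, mList_nil]
  simp [mOne, mP, Matrix.mul_apply, Fin.sum_univ_two, Matrix.vecMul, dotProduct,
    Matrix.transpose_apply]
  ring
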